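/- For every fixed t > 0, the combination giving the limiting mean eigenvalue density satisfies lim_{N→∞} [ I_{0,N}(t) · J₀(t) + (I_{1,N}(t) + I_{2,N}(t)) · J₁(t) ] = 2. -/

import Mathlib

open MeasureTheory Real Filter Complex

/-- Modified Bessel function of the first kind, integral representation. -/
noncomputable def besselI (n : ℕ) (x : ℝ) : ℝ :=
  (1 / (2 * Real.pi)) * ∫ θ in (0:ℝ)..(2 * Real.pi), Real.exp (x * Real.cos θ) * Real.cos (n * θ)

/-- `U_{0,N}`. -/
noncomputable def U0 (t : ℝ) (N : ℕ) (R₁ R₂ θ : ℝ) : ℂ :=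
  ((t * Real.sqrt (R₁ * R₂) : ℝ) : ℂ) *
      ((R₁ : ℂ) * Complex.exp (-(θ : ℂ) * Complex.I) + (R₂ : ℂ) * Complex.exp ((θ : ℂ) * Complex.I))
    + ((t ^ 2 / (N : ℝ) * (R₁ + R₂) : ℝ) : ℂ)

/-- `U_{1,N}`. -/
noncomputable def U1 (t : ℝ) (N : ℕ) (R₁ R₂ θ : ℝ) : ℂ :=
  ((t * ((N : ℝ) / ((N : ℝ) - 1)) * (R₁ * R₂) : ℝ) : ℂ)
    + ((t ^ 2 / ((N : ℝ) - 1) * Real.sqrt (R₁ * R₂) : ℝ) : ℂ) *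
        (Complex.exp ((θ : ℂ) * Complex.I) + Complex.exp (-(θ : ℂ) * Complex.I))
    - ((t ^ 2 / (N : ℝ) * Real.sqrt (R₁ * R₂) : ℝ) : ℂ) * Complex.exp ((θ : ℂ) * Complex.I)
    + ((t ^ 3 / ((N : ℝ) ^ 2 * ((N : ℝ) - 1)) : ℝ) : ℂ)

/-- `U_{2,N}`: as `U_{1,N}` with `e^{iθ}` replaced by `e^{−iθ}` in the third term. -/
noncomputable def U2 (t : ℝ) (N : ℕ) (R₁ R₂ θ : ℝ) : ℂ :=
  ((t * ((N : ℝ) / ((N : ℝ) - 1)) * (R₁ * R₂) : ℝ) : ℂ)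
    + ((t ^ 2 / ((N : ℝ) - 1) * Real.sqrt (R₁ * R₂) : ℝ) : ℂ) *
        (Complex.exp ((θ : ℂ) * Complex.I) + Complex.exp (-(θ : ℂ) * Complex.I))
    - ((t ^ 2 / (N : ℝ) * Real.sqrt (R₁ * R₂) : ℝ) : ℂ) * Complex.exp (-(θ : ℂ) * Complex.I)
    + ((t ^ 3 / ((N : ℝ) ^ 2 * ((N : ℝ) - 1)) : ℝ) : ℂ)

/-- The three functions `U_{j,N}`, `j = 0, 1, 2`. -/
noncomputable def Ufun (t : ℝ) (N : ℕ) : Fin 3 → ℝ → ℝ → ℝ → ℂ := ![U0 t N, U1 t N, U2 t N]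

/-- `F_{j,N}(R₁,R₂)`. -/
noncomputable def Ffun (t : ℝ) (N : ℕ) (j : Fin 3) (R₁ R₂ : ℝ) : ℂ :=
  (((R₁ * R₂) ^ 2)⁻¹ * (1 / (2 * Real.pi)) : ℝ) *
    ∫ θ in (0:ℝ)..(2 * Real.pi),
      (1 + (t : ℂ) * Complex.exp ((θ : ℂ) * Complex.I) / ((N : ℂ) * (Real.sqrt (R₁ * R₂) : ℝ))) ^ (N - 2) *
      (1 + (t : ℂ) * Complex.exp (-(θ : ℂ) * Complex.I) / ((N : ℂ) * (Real.sqrt (R₁ * R₂) : ℝ))) ^ (N - 2) *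
      Ufun t N j R₁ R₂ θ

/-- `I_{j,N}(t)`. -/
noncomputable def Ifun (t : ℝ) (N : ℕ) (j : Fin 3) : ℂ :=
  (((N : ℝ) / (2 * Real.pi) : ℝ) : ℂ) *
    ∫ R in (Set.Ioi (0:ℝ)) ×ˢ (Set.Ioi (0:ℝ)),
      ((Real.exp (-(N : ℝ) * (R.1 - 1 - Real.log R.1)) *
          Real.exp (-(N : ℝ) * (R.2 - 1 - Real.log R.2)) : ℝ) : ℂ) * Ffun t N j R.1 R.2

/-- `J₀(t)`. -/
noncomputable def J0 (t : ℝ) : ℝ :=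
  ∫ p in Set.Ioo (0:ℝ) 1, (1 / (p * (1 - p))) * Real.exp (-t * (p / (1 - p) + (1 - p) / p))

/-- `J₁(t)`. -/
noncomputable def J1 (t : ℝ) : ℝ :=
  (1 / 2) * ∫ p in Set.Ioo (0:ℝ) 1,
    (1 / (p * (1 - p))) * Real.exp (-t * (p / (1 - p) + (1 - p) / p)) *
      (p / (1 - p) + (1 - p) / p)

/-- The power series `∑ sᵏ / (k! (k+n)!)`, so that `I_n(2t) = tⁿ * besselSeries n (t²)`. -/
noncomputable def besselSeries (n : ℕ) (s : ℝ) : ℝ :=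
  ∑' k : ℕ, s ^ k / (k.factorial * (k + n).factorial)

/-- The integral `∫₀^∞ v⁻ⁿ e^{-v-s/v} dv`, a rescaled modified Bessel function of the second
kind. -/
noncomputable def besselIntegral (n : ℕ) (s : ℝ) : ℝ :=
  ∫ v in Set.Ioi (0:ℝ), (v ^ n)⁻¹ * Real.exp (-v - s / v)

lemma abs_besselSeries_term_le (n k : ℕ) (s : ℝ) :
    |s ^ k / (k.factorial * (k + n).factorial)| ≤ |s| ^ k / k.factorial := by
  have h1 : (1:ℝ) ≤ (k + n).factorial := by exact_mod_cast Nat.factorial_pos _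
  have h2 : (0:ℝ) < k.factorial := by exact_mod_cast Nat.factorial_pos _
  rw [abs_div, abs_pow, abs_of_pos (by positivity : (0:ℝ) < k.factorial * (k + n).factorial)]
  gcongr
  nlinarith

lemma summable_besselSeries (n : ℕ) (s : ℝ) :
    Summable fun k : ℕ => s ^ k / ((k.factorial : ℝ) * (k + n).factorial) :=
  Summable.of_norm_bounded (Real.summable_pow_div_factorial |s|)
    (fun k => abs_besselSeries_term_le n k s)

lemma hasDerivAt_besselSeries (n : ℕ) (s : ℝ) :
    HasDerivAt (besselSeries n) (besselSeries (n + 1) s) s := by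
  have key := hasDerivAt_tsum_of_isPreconnected (𝕜 := ℝ) (F := ℝ)
    (g := fun (k : ℕ) z => z ^ k / ((k.factorial : ℝ) * (k + n).factorial))
    (g' := fun (k : ℕ) z => k * z ^ (k - 1) / ((k.factorial : ℝ) * (k + n).factorial))
    (u := fun (k : ℕ) => k * (|s| + 1) ^ (k - 1) / k.factorial)
    (t := Metric.ball 0 (|s| + 1)) (y₀ := s) (y := s) ?_ Metric.isOpen_ball
    (convex_ball _ _).isPreconnected ?_ ?_ (by simp) (summable_besselSeries n s) (by simp)
  · refine key.congr_deriv ?_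
    have hs : Summable fun k : ℕ => (k : ℝ) * s ^ (k - 1) / ((k.factorial : ℝ) * (k + n).factorial) := by
      rw [← summable_nat_add_iff 1]
      refine (summable_besselSeries (n + 1) s).congr fun k => ?_
      rw [show k + 1 + n = k + (n + 1) by ring, Nat.factorial_succ k]
      push_cast
      have : (k.factorial : ℝ) ≠ 0 := by positivity
      have : (k : ℝ) + 1 ≠ 0 := by positivity
      field_simp
    rw [hs.tsum_eq_zero_add, besselSeries]
    simp only [CharP.cast_eq_zero, zero_mul, zero_div, zero_add, Nat.add_sub_cancel]
    refine tsum_congr fun k => ?_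
    rw [show k + 1 + n = k + (n + 1) by ring, Nat.factorial_succ k]
    push_cast
    have : (k.factorial : ℝ) ≠ 0 := by positivity
    have : (k : ℝ) + 1 ≠ 0 := by positivity
    field_simp
  · rw [← summable_nat_add_iff 1]
    refine (Real.summable_pow_div_factorial (|s| + 1)).congr fun k => ?_
    rw [Nat.factorial_succ k]
    push_cast
    have : (k : ℝ) + 1 ≠ 0 := by positivity
    field_simp
  · intro k y _
    exact (hasDerivAt_pow k y).div_const _
  · intro k y hy
    have hy' : |y| ≤ |s| + 1 := by
      have := mem_ball_zero_iff.1 hy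
      exact this.le
    have h1 : (1:ℝ) ≤ (k + n).factorial := by exact_mod_cast Nat.factorial_pos _
    have h2 : (0:ℝ) < k.factorial := by exact_mod_cast Nat.factorial_pos _
    rw [Real.norm_eq_abs, abs_div, abs_mul, abs_pow, Nat.abs_cast,
      abs_of_pos (by positivity : (0:ℝ) < k.factorial * (k + n).factorial)]
    gcongr
    nlinarith

lemma besselSeries_zero_eq (s : ℝ) :
    besselSeries 0 s = besselSeries 1 s + s * besselSeries 2 s := by
  unfold besselSeries
  rw [(summable_besselSeries 0 s).tsum_eq_zero_add, (summable_besselSeries 1 s).tsum_eq_zero_add,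
    ← tsum_mul_left, add_assoc, ← Summable.tsum_add]
  · congr 1
    refine tsum_congr fun k => ?_
    simp only [add_zero]
    rw [show k + 1 + 1 = (k + 1) + 1 by ring, Nat.factorial_succ (k + 1), Nat.factorial_succ k]
    push_cast
    have : (k.factorial : ℝ) ≠ 0 := by positivity
    have : (k : ℝ) + 1 ≠ 0 := by positivity
    have : (k : ℝ) + 1 + 1 ≠ 0 := by positivity
    field_simp
    ring
  · exact (summable_nat_add_iff 1).2 (summable_besselSeries 1 s)
  · exact (summable_besselSeries 2 s).mul_left s

lemma besselSeries_apply_zero (n : ℕ) : besselSeries n 0 = 1 / n.factorial := by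
  unfold besselSeries
  rw [tsum_eq_single 0]
  · simp
  · intro k hk
    simp [hk]

lemma pow_mul_besselIntegrand_le (n : ℕ) {c v : ℝ} (hc : 0 ≤ c) (hv : 0 < v) :
    c ^ n * ((v ^ n)⁻¹ * Real.exp (-v - c / v)) ≤ n.factorial * Real.exp (-v) := by
  have h := Real.pow_div_factorial_le_exp (c / v) (by positivity) n
  have h2 : (0:ℝ) < n.factorial := by positivity
  rw [div_le_iff₀ h2, div_pow] at h
  rw [sub_eq_add_neg, Real.exp_add, Real.exp_neg (c / v)]
  have h3 := Real.exp_pos (c / v)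
  calc c ^ n * ((v ^ n)⁻¹ * (Real.exp (-v) * (Real.exp (c / v))⁻¹))
      = (c ^ n / v ^ n) * (Real.exp (-v) * (Real.exp (c / v))⁻¹) := by ring
    _ ≤ (Real.exp (c / v) * n.factorial) * (Real.exp (-v) * (Real.exp (c / v))⁻¹) := by gcongr
    _ = n.factorial * Real.exp (-v) := by field_simp

lemma besselIntegrand_le (n : ℕ) {c v : ℝ} (hc : 0 < c) (hv : 0 < v) :
    (v ^ n)⁻¹ * Real.exp (-v - c / v) ≤ n.factorial / c ^ n * Real.exp (-v) := by
  have := pow_mul_besselIntegrand_le n hc.le hv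
  rw [div_mul_eq_mul_div, le_div_iff₀ (by positivity)]
  linarith

lemma measurable_besselIntegrand (n : ℕ) (s : ℝ) :
    Measurable fun v : ℝ => (v ^ n)⁻¹ * Real.exp (-v - s / v) := by
  fun_prop

lemma integrableOn_exp_neg : IntegrableOn (fun v : ℝ => Real.exp (-v)) (Set.Ioi 0) :=
  integrableOn_exp_neg_Ioi 0

lemma integrableOn_besselIntegrand (n : ℕ) {s : ℝ} (hs : 0 < s) :
    IntegrableOn (fun v : ℝ => (v ^ n)⁻¹ * Real.exp (-v - s / v)) (Set.Ioi 0) := by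
  refine Integrable.mono' (integrableOn_exp_neg.const_mul (n.factorial / s ^ n))
    (measurable_besselIntegrand n s).aestronglyMeasurable ?_
  filter_upwards [ae_restrict_mem measurableSet_Ioi] with v hv
  have hv : 0 < v := hv
  rw [Real.norm_of_nonneg (by positivity)]
  exact besselIntegrand_le n hs hv

lemma hasDerivAt_besselIntegral (n : ℕ) {s : ℝ} (hs : 0 < s) :
    HasDerivAt (besselIntegral n) (-besselIntegral (n + 1) s) s := by
  have key := (hasDerivAt_integral_of_dominated_loc_of_deriv_le (𝕜 := ℝ)
    (μ := volume.restrict (Set.Ioi (0:ℝ)))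
    (F := fun s v => (v ^ n)⁻¹ * Real.exp (-v - s / v))
    (F' := fun s v => -((v ^ (n + 1))⁻¹ * Real.exp (-v - s / v)))
    (bound := fun v => (n + 1).factorial / (s / 2) ^ (n + 1) * Real.exp (-v))
    (x₀ := s) (Ioi_mem_nhds (show s / 2 < s by linarith))
    (Eventually.of_forall fun x => (measurable_besselIntegrand n x).aestronglyMeasurable)
    (integrableOn_besselIntegrand n hs)
    (measurable_besselIntegrand (n + 1) s).neg.aestronglyMeasurable ?_
    (integrableOn_exp_neg.const_mul _) ?_).2
  · rw [integral_neg] at key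
    exact key
  · filter_upwards [ae_restrict_mem measurableSet_Ioi] with v hv x hx
    have hv : 0 < v := hv
    have hx : s / 2 < x := hx
    rw [norm_neg, Real.norm_of_nonneg (by positivity)]
    refine le_trans ?_ (besselIntegrand_le (n + 1) (half_pos hs) hv)
    gcongr
  · filter_upwards [ae_restrict_mem measurableSet_Ioi] with v hv x hx
    have hv : 0 < v := hv
    have h1 : HasDerivAt (fun x : ℝ => -v - x / v) (-(1 / v)) x := by
      simpa using ((hasDerivAt_id x).div_const v).const_sub (-v)
    refine (h1.exp.const_mul (v ^ n)⁻¹).congr_deriv ?_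
    rw [pow_succ, mul_inv]
    ring

lemma mul_besselIntegral_two {s : ℝ} (hs : 0 < s) :
    s * besselIntegral 2 s = besselIntegral 0 s := by
  have key := integral_Ioi_of_hasDerivAt_of_tendsto (a := (0:ℝ)) (m := 0)
    (f := fun v => v * (v⁻¹ * Real.exp (-v - s / v)))
    (f' := fun v => s * ((v ^ 2)⁻¹ * Real.exp (-v - s / v))
      - (v ^ 0)⁻¹ * Real.exp (-v - s / v)) ?_ ?_
    (((integrableOn_besselIntegrand 2 hs).const_mul s).sub (integrableOn_besselIntegrand 0 hs)) ?_
  · rw [integral_sub ((integrableOn_besselIntegrand 2 hs).const_mul s)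
      (integrableOn_besselIntegrand 0 hs), integral_const_mul] at key
    simp only [zero_mul, sub_zero] at key
    exact sub_eq_zero.1 key
  · have hT : Tendsto (fun v : ℝ => v * s⁻¹) (nhdsWithin 0 (Set.Ici 0)) (nhds 0) := by
      have : Tendsto (fun v : ℝ => v * s⁻¹) (nhds 0) (nhds (0 * s⁻¹)) :=
        (continuous_id.mul continuous_const).tendsto 0
      rw [zero_mul] at this
      exact this.mono_left nhdsWithin_le_nhds
    unfold ContinuousWithinAt
    simp only [zero_mul]
    refine tendsto_of_tendsto_of_tendsto_of_le_of_le' tendsto_const_nhds hT ?_ ?_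
    · filter_upwards [self_mem_nhdsWithin] with v hv
      have hv : 0 ≤ v := hv
      positivity
    · filter_upwards [self_mem_nhdsWithin] with v hv
      have hv : 0 ≤ v := hv
      rcases hv.eq_or_lt with rfl | hv
      · simp
      have h := besselIntegrand_le 1 hs hv
      have h2 : Real.exp (-v) ≤ 1 := Real.exp_le_one_iff.2 (by linarith)
      simp only [pow_one, Nat.factorial_one, Nat.cast_one, one_div] at h
      gcongr
      refine h.trans ?_
      exact mul_le_of_le_one_right (by positivity) h2
  · intro v hv
    have hv : 0 < v := hv
    have h1 : HasDerivAt (fun v : ℝ => -v - s / v) (-1 + s * (v ^ 2)⁻¹) v := by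
      simp only [div_eq_mul_inv]
      refine ((hasDerivAt_id v).neg.sub ((hasDerivAt_inv hv.ne').const_mul s)).congr_deriv ?_
      ring
    refine HasDerivAt.congr_of_eventuallyEq (f := fun v => Real.exp (-v - s / v)) ?_ ?_
    · refine h1.exp.congr_deriv ?_
      ring
    · filter_upwards [Ioi_mem_nhds hv] with w hw
      have hw : 0 < w := hw
      field_simp
  · have hT : Tendsto (fun v : ℝ => Real.exp (-v)) atTop (nhds 0) :=
      Real.tendsto_exp_neg_atTop_nhds_zero
    refine tendsto_of_tendsto_of_tendsto_of_le_of_le' tendsto_const_nhds hT ?_ ?_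
    · filter_upwards [eventually_gt_atTop 0] with v hv
      positivity
    · filter_upwards [eventually_gt_atTop 0] with v hv
      rw [mul_inv_cancel_left₀ hv.ne']
      have : 0 < s / v := by positivity
      gcongr
      linarith

lemma tendsto_pow_mul_besselIntegral_zero (n : ℕ) :
    Tendsto (fun s => s ^ n * besselIntegral n s) (nhdsWithin 0 (Set.Ioi 0))
      (nhds (if n = 0 then 1 else 0)) := by
  have key := tendsto_integral_filter_of_dominated_convergence
    (μ := volume.restrict (Set.Ioi (0:ℝ))) (l := nhdsWithin (0:ℝ) (Set.Ioi 0))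
    (F := fun s v => s ^ n * ((v ^ n)⁻¹ * Real.exp (-v - s / v)))
    (f := fun v => (if n = 0 then 1 else 0) * Real.exp (-v))
    (fun v => n.factorial * Real.exp (-v))
    (Eventually.of_forall fun s => ((measurable_besselIntegrand n s).const_mul _).aestronglyMeasurable)
    ?_ (integrableOn_exp_neg.const_mul _) ?_
  · simp only [integral_const_mul, integral_exp_neg_Ioi_zero, mul_one] at key
    exact key
  · filter_upwards [self_mem_nhdsWithin] with s hs
    have hs : 0 < s := hs
    filter_upwards [ae_restrict_mem measurableSet_Ioi] with v hv
    have hv : 0 < v := hv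
    rw [Real.norm_of_nonneg (by positivity)]
    exact pow_mul_besselIntegrand_le n hs.le hv
  · filter_upwards [ae_restrict_mem measurableSet_Ioi] with v hv
    have hv : 0 < v := hv
    have hc : Continuous fun s : ℝ => s ^ n * ((v ^ n)⁻¹ * Real.exp (-v - s / v)) := by fun_prop
    have := (hc.tendsto 0).mono_left (nhdsWithin_le_nhds (s := Set.Ioi 0))
    convert this using 2
    rcases n with _ | n <;> simp

/-- The Wronskian relation `I₁K₀ + I₀K₁ = 1/x` in rescaled form. -/
lemma bessel_wronskian {s : ℝ} (hs : 0 < s) :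
    s * besselSeries 1 s * besselIntegral 1 s + besselSeries 0 s * besselIntegral 0 s = 1 := by
  set W : ℝ → ℝ := fun s =>
    s * besselSeries 1 s * besselIntegral 1 s + besselSeries 0 s * besselIntegral 0 s with hW
  have hd : ∀ x ∈ Set.Ioi (0:ℝ), HasDerivAt W 0 x := by
    intro x hx
    have hx : 0 < x := hx
    have h := (((hasDerivAt_id x).mul (hasDerivAt_besselSeries 1 x)).mul
      (hasDerivAt_besselIntegral 1 hx)).add
      ((hasDerivAt_besselSeries 0 x).mul (hasDerivAt_besselIntegral 0 hx))
    refine h.congr_deriv ?_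
    have h1 := besselSeries_zero_eq x
    have h2 := mul_besselIntegral_two hx
    simp only [id, Pi.mul_apply, zero_add, one_mul, Nat.reduceAdd]
    rw [h1, ← h2]
    ring
  have hconst : ∀ x ∈ Set.Ioi (0:ℝ), W x = W s := fun x hx =>
    isOpen_Ioi.is_const_of_deriv_eq_zero isPreconnected_Ioi
      (fun y hy => (hd y hy).differentiableAt.differentiableWithinAt)
      (fun y hy => (hd y hy).deriv) hx hs
  have hc : ∀ n, Tendsto (besselSeries n) (nhdsWithin 0 (Set.Ioi 0)) (nhds (besselSeries n 0)) :=
    fun n => (hasDerivAt_besselSeries n 0).continuousAt.tendsto.mono_left nhdsWithin_le_nhds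
  have hlim : Tendsto W (nhdsWithin 0 (Set.Ioi 0)) (nhds 1) := by
    have h := ((hc 1).mul (tendsto_pow_mul_besselIntegral_zero 1)).add
      ((hc 0).mul (tendsto_pow_mul_besselIntegral_zero 0))
    simp only [besselSeries_apply_zero] at h
    convert h using 2
    · simp only [hW]
      ring
    · simp
  refine tendsto_nhds_unique (f := W) (l := nhdsWithin 0 (Set.Ioi 0)) ?_ hlim
  refine (tendsto_const_nhds (x := W s)).congr' ?_
  filter_upwards [self_mem_nhdsWithin] with x hx
  exact (hconst x hx).symm

lemma setIntegral_Ioo_comp_odds {t : ℝ} (ht : 0 < t) (g : ℝ → ℝ) :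
    ∫ v in Set.Ioi (0:ℝ), g v =
      ∫ p in Set.Ioo (0:ℝ) 1, t / (1 - p) ^ 2 * g (t * (p / (1 - p))) := by
  have himg : (fun p : ℝ => t * (p / (1 - p))) '' Set.Ioo 0 1 = Set.Ioi 0 := by
    ext v
    constructor
    · rintro ⟨p, ⟨h0, h1⟩, rfl⟩
      have : 0 < 1 - p := by linarith
      exact mul_pos ht (div_pos h0 this)
    · intro hv
      have hv : 0 < v := hv
      refine ⟨v / (t + v), ⟨by positivity, ?_⟩, ?_⟩
      · rw [div_lt_one (by positivity)]
        linarith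
      · have : 1 - v / (t + v) = t / (t + v) := by field_simp; ring
        simp only [this]
        field_simp
  rw [← himg, integral_image_eq_integral_abs_deriv_smul
    (f' := fun p => t / (1 - p) ^ 2) measurableSet_Ioo]
  · refine setIntegral_congr_fun measurableSet_Ioo fun p hp => ?_
    have : 0 < 1 - p := by linarith [hp.2]
    simp only [smul_eq_mul]
    rw [abs_of_pos (by positivity)]
  · intro p hp
    have : 1 - p ≠ 0 := by linarith [hp.2]
    refine HasDerivAt.hasDerivWithinAt ?_
    refine (((hasDerivAt_id p).div ((hasDerivAt_id p).const_sub 1) this).const_mul t).congr_deriv ?_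
    simp only [id]
    field_simp
    ring
  · intro p hp q hq h
    have h1 : 1 - p ≠ 0 := by linarith [hp.2]
    have h2 : 1 - q ≠ 0 := by linarith [hq.2]
    simp only at h
    field_simp at h
    linarith

lemma J0_eq {t : ℝ} (ht : 0 < t) : J0 t = besselIntegral 1 (t ^ 2) := by
  unfold J0 besselIntegral
  rw [setIntegral_Ioo_comp_odds ht]
  refine setIntegral_congr_fun measurableSet_Ioo fun p hp => ?_
  have h0 : p ≠ 0 := hp.1.ne'
  have h1 : 1 - p ≠ 0 := by linarith [hp.2]
  have he : -(t * (p / (1 - p))) - t ^ 2 / (t * (p / (1 - p)))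
      = -t * (p / (1 - p) + (1 - p) / p) := by
    field_simp
    ring
  simp only [he]
  rw [← mul_assoc]
  congr 1
  field_simp

lemma mul_J1_eq {t : ℝ} (ht : 0 < t) : t * J1 t = besselIntegral 0 (t ^ 2) := by
  have ht2 : 0 < t ^ 2 := by positivity
  have h : t * J1 t = (1 / 2) * ∫ v in Set.Ioi (0:ℝ),
      ((v ^ 0)⁻¹ * Real.exp (-v - t ^ 2 / v)
        + t ^ 2 * ((v ^ 2)⁻¹ * Real.exp (-v - t ^ 2 / v))) := by
    unfold J1
    rw [setIntegral_Ioo_comp_odds ht, mul_left_comm, ← integral_const_mul]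
    congr 1
    refine setIntegral_congr_fun measurableSet_Ioo fun p hp => ?_
    have h0 : p ≠ 0 := hp.1.ne'
    have h1 : 1 - p ≠ 0 := by linarith [hp.2]
    have he : -(t * (p / (1 - p))) - t ^ 2 / (t * (p / (1 - p)))
        = -t * (p / (1 - p) + (1 - p) / p) := by
      field_simp
      ring
    simp only [he]
    field_simp
  rw [integral_add (integrableOn_besselIntegrand 0 ht2)
    ((integrableOn_besselIntegrand 2 ht2).const_mul _), integral_const_mul] at h
  have h2 := mul_besselIntegral_two ht2
  unfold besselIntegral at h2 ⊢
  rw [h, h2]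
  ring

lemma integral_exp_int_mul_I (n : ℤ) :
    ∫ θ in (0:ℝ)..(2 * Real.pi), Complex.exp (n * ((θ : ℂ) * Complex.I)) =
      if n = 0 then 2 * (Real.pi : ℂ) else 0 := by
  split_ifs with h
  · subst h
    simp
  · have hc : (n : ℂ) * Complex.I ≠ 0 := mul_ne_zero (by exact_mod_cast h) Complex.I_ne_zero
    have h1 : ∀ θ : ℝ, (n : ℂ) * ((θ : ℂ) * Complex.I) = (n * Complex.I) * θ := fun θ => by ring
    simp only [h1]
    rw [integral_exp_mul_complex hc]
    have h2 : (n : ℂ) * Complex.I * ((2 * Real.pi : ℝ) : ℂ) = n * (2 * Real.pi * Complex.I) := by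
      push_cast
      ring
    rw [h2, Complex.exp_int_mul_two_pi_mul_I]
    simp

lemma integral_one_add_exp_pow_mul (m : ℕ) (x : ℂ) (l : ℤ) :
    ∫ θ in (0:ℝ)..(2 * Real.pi), (1 + x * Complex.exp ((θ : ℂ) * Complex.I)) ^ m *
      (1 + x * Complex.exp (-(θ : ℂ) * Complex.I)) ^ m * Complex.exp (l * ((θ : ℂ) * Complex.I)) =
    ∑ j ∈ Finset.range (m + 1), ∑ k ∈ Finset.range (m + 1),
      (m.choose j : ℂ) * m.choose k * x ^ (j + k) *
        if (j : ℤ) - k + l = 0 then 2 * (Real.pi : ℂ) else 0 := by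
  have hexp : ∀ θ : ℝ, (1 + x * Complex.exp ((θ : ℂ) * Complex.I)) ^ m *
      (1 + x * Complex.exp (-(θ : ℂ) * Complex.I)) ^ m * Complex.exp (l * ((θ : ℂ) * Complex.I)) =
      ∑ j ∈ Finset.range (m + 1), ∑ k ∈ Finset.range (m + 1),
      (m.choose j : ℂ) * m.choose k * x ^ (j + k) *
        Complex.exp (((j : ℤ) - k + l : ℤ) * ((θ : ℂ) * Complex.I)) := by
    intro θ
    rw [add_comm 1, add_comm 1, add_pow, add_pow, Finset.sum_mul_sum, Finset.sum_mul]
    refine Finset.sum_congr rfl fun j _ => ?_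
    rw [Finset.sum_mul]
    refine Finset.sum_congr rfl fun k _ => ?_
    have h : Complex.exp (((j : ℤ) - k + l : ℤ) * ((θ : ℂ) * Complex.I)) =
        Complex.exp ((θ : ℂ) * Complex.I) ^ j * Complex.exp (-(θ : ℂ) * Complex.I) ^ k *
          Complex.exp (l * ((θ : ℂ) * Complex.I)) := by
      rw [← Complex.exp_nat_mul, ← Complex.exp_nat_mul, ← Complex.exp_add, ← Complex.exp_add]
      congr 1
      push_cast
      ring
    rw [h]
    simp only [one_pow, mul_one, mul_pow, pow_add]
    ring
  simp only [hexp]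
  rw [intervalIntegral.integral_finsetSum]
  · refine Finset.sum_congr rfl fun j _ => ?_
    rw [intervalIntegral.integral_finsetSum]
    · refine Finset.sum_congr rfl fun k _ => ?_
      rw [intervalIntegral.integral_const_mul, integral_exp_int_mul_I]
    · intro k _
      exact Continuous.intervalIntegrable (by fun_prop) _ _
  · intro j _
    exact Continuous.intervalIntegrable (by fun_prop) _ _

lemma integral_one_add_exp_pow_trig (m : ℕ) (x c₀ c₁ c₂ : ℂ) :
    ∫ θ in (0:ℝ)..(2 * Real.pi), (1 + x * Complex.exp ((θ : ℂ) * Complex.I)) ^ m *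
      (1 + x * Complex.exp (-(θ : ℂ) * Complex.I)) ^ m *
      (c₀ + c₁ * Complex.exp ((θ : ℂ) * Complex.I) + c₂ * Complex.exp (-(θ : ℂ) * Complex.I)) =
    2 * Real.pi * (c₀ * ∑ k ∈ Finset.range (m + 1), (m.choose k : ℂ) ^ 2 * x ^ (2 * k) +
      (c₁ + c₂) * ∑ k ∈ Finset.range (m + 1),
        (m.choose k : ℂ) * m.choose (k + 1) * x ^ (2 * k + 1)) := by
  have h0 := integral_one_add_exp_pow_mul m x 0
  have h1 := integral_one_add_exp_pow_mul m x 1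
  have h2 := integral_one_add_exp_pow_mul m x (-1)
  have e0 : ∑ j ∈ Finset.range (m + 1), ∑ k ∈ Finset.range (m + 1),
      (m.choose j : ℂ) * m.choose k * x ^ (j + k) *
        (if (j : ℤ) - k + 0 = 0 then 2 * (Real.pi : ℂ) else 0) =
      2 * Real.pi * ∑ k ∈ Finset.range (m + 1), (m.choose k : ℂ) ^ 2 * x ^ (2 * k) := by
    rw [Finset.mul_sum]
    refine Finset.sum_congr rfl fun j hj => ?_
    rw [Finset.sum_eq_single_of_mem j hj]
    · simp
      ring
    · intro k _ hk
      rw [if_neg (by omega), mul_zero]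
  have e1 : ∑ j ∈ Finset.range (m + 1), ∑ k ∈ Finset.range (m + 1),
      (m.choose j : ℂ) * m.choose k * x ^ (j + k) *
        (if (j : ℤ) - k + 1 = 0 then 2 * (Real.pi : ℂ) else 0) =
      2 * Real.pi * ∑ k ∈ Finset.range (m + 1),
        (m.choose k : ℂ) * m.choose (k + 1) * x ^ (2 * k + 1) := by
    rw [Finset.mul_sum]
    refine Finset.sum_congr rfl fun j hj => ?_
    rw [Finset.sum_eq_single (j + 1)]
    · rw [if_pos (by push_cast; ring)]
      ring
    · intro k _ hk
      rw [if_neg (by omega), mul_zero]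
    · intro hk
      have : m < j + 1 := by simpa using hk
      rw [Nat.choose_eq_zero_of_lt this]
      simp
  have e2 : ∑ j ∈ Finset.range (m + 1), ∑ k ∈ Finset.range (m + 1),
      (m.choose j : ℂ) * m.choose k * x ^ (j + k) *
        (if (j : ℤ) - k + -1 = 0 then 2 * (Real.pi : ℂ) else 0) =
      2 * Real.pi * ∑ k ∈ Finset.range (m + 1),
        (m.choose k : ℂ) * m.choose (k + 1) * x ^ (2 * k + 1) := by
    rw [← e1, Finset.sum_comm]
    refine Finset.sum_congr rfl fun j _ => Finset.sum_congr rfl fun k _ => ?_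
    rw [add_comm k j, mul_comm (m.choose k : ℂ)]
    congr 1
    refine if_congr ?_ rfl rfl
    omega
  rw [e0] at h0
  rw [e1] at h1
  rw [e2] at h2
  have hsplit : ∀ θ : ℝ, (1 + x * Complex.exp ((θ : ℂ) * Complex.I)) ^ m *
      (1 + x * Complex.exp (-(θ : ℂ) * Complex.I)) ^ m *
      (c₀ + c₁ * Complex.exp ((θ : ℂ) * Complex.I) + c₂ * Complex.exp (-(θ : ℂ) * Complex.I)) =
      c₀ * ((1 + x * Complex.exp ((θ : ℂ) * Complex.I)) ^ m *
        (1 + x * Complex.exp (-(θ : ℂ) * Complex.I)) ^ m *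
          Complex.exp ((0 : ℤ) * ((θ : ℂ) * Complex.I))) +
      c₁ * ((1 + x * Complex.exp ((θ : ℂ) * Complex.I)) ^ m *
        (1 + x * Complex.exp (-(θ : ℂ) * Complex.I)) ^ m *
          Complex.exp ((1 : ℤ) * ((θ : ℂ) * Complex.I))) +
      c₂ * ((1 + x * Complex.exp ((θ : ℂ) * Complex.I)) ^ m *
        (1 + x * Complex.exp (-(θ : ℂ) * Complex.I)) ^ m *
          Complex.exp ((-1 : ℤ) * ((θ : ℂ) * Complex.I))) := by
    intro θ
    have e3 : ((-1 : ℤ) : ℂ) * ((θ : ℂ) * Complex.I) = -(θ : ℂ) * Complex.I := by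
      push_cast
      ring
    rw [e3]
    simp only [Int.cast_zero, zero_mul, Complex.exp_zero, Int.cast_one, one_mul, mul_one]
    ring
  simp only [hsplit]
  rw [intervalIntegral.integral_add, intervalIntegral.integral_add,
    intervalIntegral.integral_const_mul, intervalIntegral.integral_const_mul,
    intervalIntegral.integral_const_mul, h0, h1, h2]
  · ring
  all_goals exact Continuous.intervalIntegrable (by fun_prop) _ _

/-- The radial weight `e^{-N(R-1-log R)} R⁻ᵖ`. -/
noncomputable def radialWeight (N p : ℕ) (R : ℝ) : ℝ :=
  Real.exp (-(N : ℝ) * (R - 1 - Real.log R)) * (R ^ p)⁻¹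

/-- The moments `∫₀^∞ e^{-N(R-1-log R)} R⁻ᵖ dR` in closed form. -/
noncomputable def radialMoment (N p : ℕ) : ℝ :=
  Real.exp N * (N - p).factorial / (N : ℝ) ^ (N - p + 1)

lemma radialWeight_eq {N p : ℕ} (hp : p ≤ N) {R : ℝ} (hR : 0 < R) :
    radialWeight N p R =
      Real.exp N * (R ^ (((N - p : ℕ) : ℝ) + 1 - 1) * Real.exp (-(N * R))) := by
  have h : Real.exp (-(N : ℝ) * (R - 1 - Real.log R)) =
      Real.exp N * Real.exp (-(N * R)) * R ^ N := by
    rw [← Real.exp_log (pow_pos hR N), Real.log_pow, ← Real.exp_add, ← Real.exp_add]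
    congr 1
    ring
  rw [radialWeight, h, add_sub_cancel_right, Real.rpow_natCast]
  obtain ⟨r, rfl⟩ := Nat.exists_eq_add_of_le hp
  rw [Nat.add_sub_cancel_left, pow_add]
  field_simp

lemma integrableOn_radialWeight {N p : ℕ} (hN : 0 < N) (hp : p ≤ N) :
    IntegrableOn (radialWeight N p) (Set.Ioi 0) := by
  have hN' : (0:ℝ) < N := by exact_mod_cast hN
  have h := (integrableOn_rpow_mul_exp_neg_mul_rpow (p := 1) (s := ((N - p : ℕ) : ℝ))
    (by linarith [(Nat.cast_nonneg (N - p) : (0:ℝ) ≤ ((N - p : ℕ) : ℝ))]) one_pos hN').const_mul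
    (Real.exp N)
  refine IntegrableOn.congr_fun h (fun R hR => ?_) measurableSet_Ioi
  have hR : 0 < R := hR
  rw [radialWeight_eq hp hR, add_sub_cancel_right, Real.rpow_one, neg_mul]

lemma integral_radialWeight {N p : ℕ} (hN : 0 < N) (hp : p ≤ N) :
    ∫ R in Set.Ioi (0:ℝ), radialWeight N p R = radialMoment N p := by
  have hN' : (0:ℝ) < N := by exact_mod_cast hN
  rw [setIntegral_congr_fun measurableSet_Ioi fun R hR => radialWeight_eq hp hR,
    integral_const_mul, Real.integral_rpow_mul_exp_neg_mul_Ioi (by positivity) hN',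
    Real.Gamma_nat_eq_factorial, radialMoment,
    show ((N - p : ℕ) : ℝ) + 1 = ((N - p + 1 : ℕ) : ℝ) by push_cast; ring, Real.rpow_natCast,
    one_div, inv_pow]
  field_simp

lemma integrable_radialWeight_mul {N p q : ℕ} (hN : 0 < N) (hp : p ≤ N) (hq : q ≤ N) :
    IntegrableOn (fun R : ℝ × ℝ => radialWeight N p R.1 * radialWeight N q R.2)
      (Set.Ioi (0:ℝ) ×ˢ Set.Ioi (0:ℝ)) := by
  have := (integrableOn_radialWeight hN hp).mul_prod (integrableOn_radialWeight hN hq)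
  rwa [Measure.prod_restrict] at this

lemma integral_radialWeight_mul {N p q : ℕ} (hN : 0 < N) (hp : p ≤ N) (hq : q ≤ N) :
    ∫ R in Set.Ioi (0:ℝ) ×ˢ Set.Ioi (0:ℝ), radialWeight N p R.1 * radialWeight N q R.2 =
      radialMoment N p * radialMoment N q := by
  rw [← integral_radialWeight hN hp, ← integral_radialWeight hN hq]
  exact setIntegral_prod_mul _ _ _ _

lemma integral_sum_radialWeight {N : ℕ} (hN : 2 ≤ N) (α β γ : ℕ → ℝ) :
    ∫ R in Set.Ioi (0:ℝ) ×ˢ Set.Ioi (0:ℝ), ∑ k ∈ Finset.range (N - 1),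
      (α k * (radialWeight N (k + 1) R.1 * radialWeight N (k + 1) R.2) +
        β k * (radialWeight N (k + 2) R.1 * radialWeight N (k + 2) R.2) +
        γ k * (radialWeight N (k + 1) R.1 * radialWeight N (k + 2) R.2 +
          radialWeight N (k + 2) R.1 * radialWeight N (k + 1) R.2)) =
    ∑ k ∈ Finset.range (N - 1),
      (α k * radialMoment N (k + 1) ^ 2 + β k * radialMoment N (k + 2) ^ 2 +
        γ k * (2 * (radialMoment N (k + 1) * radialMoment N (k + 2)))) := by
  have hN0 : 0 < N := by omega
  rw [integral_finsetSum]
  · refine Finset.sum_congr rfl fun k hk => ?_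
    have hk := Finset.mem_range.1 hk
    have h1 : k + 1 ≤ N := by omega
    have h2 : k + 2 ≤ N := by omega
    have i11 := integrable_radialWeight_mul hN0 h1 h1
    have i12 := integrable_radialWeight_mul hN0 h1 h2
    have i21 := integrable_radialWeight_mul hN0 h2 h1
    have i22 := integrable_radialWeight_mul hN0 h2 h2
    rw [integral_add, integral_add, integral_const_mul, integral_const_mul,
      integral_const_mul, integral_add, integral_radialWeight_mul hN0 h1 h1,
      integral_radialWeight_mul hN0 h1 h2, integral_radialWeight_mul hN0 h2 h1,
      integral_radialWeight_mul hN0 h2 h2]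
    · ring
    · exact i12
    · exact i21
    · exact i11.const_mul _
    · exact i22.const_mul _
    · exact (i11.const_mul _).add (i22.const_mul _)
    · exact (i12.add i21).const_mul _
  · intro k hk
    have hk := Finset.mem_range.1 hk
    have h1 : k + 1 ≤ N := by omega
    have h2 : k + 2 ≤ N := by omega
    exact (((integrable_radialWeight_mul hN0 h1 h1).const_mul _).add
      ((integrable_radialWeight_mul hN0 h2 h2).const_mul _)).add
      (((integrable_radialWeight_mul hN0 h1 h2).add
        (integrable_radialWeight_mul hN0 h2 h1)).const_mul _)

lemma Ffun_eq {t : ℝ} {N : ℕ} (hN : 2 ≤ N) (j : Fin 3) {R₁ R₂ : ℝ} (h₁ : 0 < R₁) (h₂ : 0 < R₂)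
    {a₀ a₁ a₂ b₀ b₁ c₁ c₂ : ℝ}
    (hc : c₁ + c₂ = Real.sqrt (R₁ * R₂) * (b₀ + b₁ * (R₁ + R₂)))
    (hU : ∀ θ : ℝ, Ufun t N j R₁ R₂ θ = ((a₀ * (R₁ * R₂) + a₁ + a₂ * (R₁ + R₂) : ℝ) : ℂ) +
      c₁ * Complex.exp ((θ : ℂ) * Complex.I) + c₂ * Complex.exp (-(θ : ℂ) * Complex.I)) :
    Ffun t N j R₁ R₂ = ((∑ k ∈ Finset.range (N - 1),
      (((N - 2).choose k : ℝ) ^ 2 * (t / N) ^ (2 * k) * (a₀ * (R₁ * R₂) + a₁ + a₂ * (R₁ + R₂)) +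
        ((N - 2).choose k : ℝ) * (N - 2).choose (k + 1) * (t / N) ^ (2 * k + 1) *
          (b₀ + b₁ * (R₁ + R₂))) * ((R₁ * R₂) ^ (k + 2))⁻¹ : ℝ) : ℂ) := by
  set s := Real.sqrt (R₁ * R₂) with hs
  have hs0 : 0 < s := Real.sqrt_pos.2 (mul_pos h₁ h₂)
  have hs2 : R₁ * R₂ = s ^ 2 := (Real.sq_sqrt (mul_pos h₁ h₂).le).symm
  have hN0 : (0:ℝ) < N := by exact_mod_cast (by omega : 0 < N)
  have hx : ∀ z : ℂ, (t : ℂ) * z / ((N : ℂ) * (s : ℂ)) = ((t / N / s : ℝ) : ℂ) * z := by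
    intro z
    push_cast
    field_simp
  have hpi : (Real.pi : ℂ) ≠ 0 := by exact_mod_cast Real.pi_ne_zero
  unfold Ffun
  simp only [hU, ← hs, hx]
  rw [integral_one_add_exp_pow_trig, show N - 2 + 1 = N - 1 by omega]
  have hc' : (c₁ : ℂ) + c₂ = ((s * (b₀ + b₁ * (R₁ + R₂)) : ℝ) : ℂ) := by
    rw [← hc]
    push_cast
    ring
  rw [hc']
  norm_cast
  rw [← mul_assoc, show ((R₁ * R₂) ^ 2)⁻¹ * (1 / (2 * Real.pi)) * (2 * Real.pi)
    = ((R₁ * R₂) ^ 2)⁻¹ by field_simp]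
  rw [Finset.mul_sum, Finset.mul_sum, ← Finset.sum_add_distrib, Finset.mul_sum]
  refine Finset.sum_congr rfl fun k _ => ?_
  generalize a₀ * (R₁ * R₂) + a₁ + a₂ * (R₁ + R₂) = A
  generalize b₀ + b₁ * (R₁ + R₂) = B
  rw [hs2, div_pow _ s, div_pow _ s]
  generalize t / (N : ℝ) = a
  field_simp
  ring

lemma Ifun_eq {t : ℝ} {N : ℕ} (hN : 2 ≤ N) (j : Fin 3) (a₀ a₁ a₂ b₀ b₁ : ℝ)
    (hU : ∀ R₁ R₂ : ℝ, 0 < R₁ → 0 < R₂ → ∃ c₁ c₂ : ℝ,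
      c₁ + c₂ = Real.sqrt (R₁ * R₂) * (b₀ + b₁ * (R₁ + R₂)) ∧
      ∀ θ : ℝ, Ufun t N j R₁ R₂ θ = ((a₀ * (R₁ * R₂) + a₁ + a₂ * (R₁ + R₂) : ℝ) : ℂ) +
      c₁ * Complex.exp ((θ : ℂ) * Complex.I) + c₂ * Complex.exp (-(θ : ℂ) * Complex.I)) :
    Ifun t N j = ((N / (2 * Real.pi) * ∑ k ∈ Finset.range (N - 1),
      (((N - 2).choose k : ℝ) ^ 2 * (t / N) ^ (2 * k) * a₀ * radialMoment N (k + 1) ^ 2 +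
       (((N - 2).choose k : ℝ) ^ 2 * (t / N) ^ (2 * k) * a₁ +
        ((N - 2).choose k : ℝ) * (N - 2).choose (k + 1) * (t / N) ^ (2 * k + 1) * b₀) *
          radialMoment N (k + 2) ^ 2 +
       (((N - 2).choose k : ℝ) ^ 2 * (t / N) ^ (2 * k) * a₂ +
        ((N - 2).choose k : ℝ) * (N - 2).choose (k + 1) * (t / N) ^ (2 * k + 1) * b₁) *
          (2 * (radialMoment N (k + 1) * radialMoment N (k + 2)))) : ℝ) : ℂ) := by
  unfold Ifun
  rw [Complex.ofReal_mul, ← integral_sum_radialWeight hN, ← integral_complex_ofReal]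
  congr 1
  refine setIntegral_congr_fun (measurableSet_Ioi.prod measurableSet_Ioi) fun R hR => ?_
  have h₁ : 0 < R.1 := hR.1
  have h₂ : 0 < R.2 := hR.2
  obtain ⟨c₁, c₂, hc, hU⟩ := hU R.1 R.2 h₁ h₂
  rw [Ffun_eq hN j h₁ h₂ hc hU, ← Complex.ofReal_mul, Finset.mul_sum]
  congr 1
  refine Finset.sum_congr rfl fun k _ => ?_
  simp only [radialWeight]
  field_simp
  ring

/-- The common prefactor of the `Ifun`, which tends to `1` by Stirling's formula. -/
noncomputable def stirlingFactor (N : ℕ) : ℝ := N / (2 * Real.pi) * radialMoment N 0 ^ 2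

lemma tendsto_stirlingFactor : Tendsto stirlingFactor atTop (nhds 1) := by
  have h := (Stirling.tendsto_stirlingSeq_sqrt_pi.pow 2).div_const Real.pi
  rw [Real.sq_sqrt Real.pi_pos.le, div_self Real.pi_ne_zero] at h
  refine h.congr' ?_
  filter_upwards [eventually_gt_atTop 0] with N hN
  have hN' : (0:ℝ) < N := by exact_mod_cast hN
  have hpi := Real.pi_pos
  rw [Stirling.stirlingSeq, stirlingFactor, radialMoment, div_pow, mul_pow,
    Real.sq_sqrt (by positivity), div_pow (N : ℝ), ← Real.exp_nat_mul, mul_one, Nat.sub_zero]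
  field_simp
  ring

/-- Normalised form of `binom (N-2) k N⁻ᵏ radialMoment N (k+1)`. -/
noncomputable def momentCoeffA (N k : ℕ) : ℝ := ((N : ℝ) - k - 1) / (((N : ℝ) - 1) * k.factorial)

/-- Normalised form of `binom (N-2) k N⁻ᵏ radialMoment N (k+2)`. -/
noncomputable def momentCoeffB (N k : ℕ) : ℝ := (N : ℝ) / (((N : ℝ) - 1) * k.factorial)

/-- Normalised form of `binom (N-2) (k+1) N⁻ᵏ⁻¹ radialMoment N (k+2)`. -/
noncomputable def momentCoeffC (N k : ℕ) : ℝ :=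
  ((N : ℝ) - k - 2) / (((N : ℝ) - 1) * (k + 1).factorial)

lemma choose_mul_radialMoment_succ {N k : ℕ} (hk : k + 2 ≤ N) :
    ((N - 2).choose k : ℝ) * radialMoment N (k + 1) =
      (N : ℝ) ^ k * (radialMoment N 0 * momentCoeffA N k) := by
  obtain ⟨r, rfl⟩ := Nat.exists_eq_add_of_le hk
  have h1 : k + 2 + r - 2 = k + r := by omega
  have h2 : k + 2 + r - (k + 1) = r + 1 := by omega
  have h3 : ((k + r).choose k : ℝ) = (k + r).factorial / (k.factorial * r.factorial) :=
    Nat.cast_add_choose ℝ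
  have h4 : ((k + 2 + r).factorial : ℝ) = (k + r + 2) * ((k + r + 1) * (k + r).factorial) := by
    rw [show k + 2 + r = k + r + 1 + 1 by ring, Nat.factorial_succ, Nat.factorial_succ]
    push_cast
    ring
  have h5 : ((k + 2 + r : ℕ) : ℝ) - 1 = k + r + 1 := by push_cast; ring
  have h6 : ((k + 2 + r : ℕ) : ℝ) - k - 1 = r + 1 := by push_cast; ring
  have h7 : ((r + 1).factorial : ℝ) = (r + 1) * r.factorial := by
    rw [Nat.factorial_succ]
    push_cast
    ring
  have h8 : ((k + 2 + r : ℕ) : ℝ) = k + r + 2 := by push_cast; ring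
  rw [radialMoment, radialMoment, momentCoeffA, h6, h5, h1, h2, h3, Nat.sub_zero, h4, h7, h8,
    show k + 2 + r + 1 = k + (r + 1 + 1) + 1 by ring]
  field_simp
  ring

lemma choose_mul_radialMoment_add_two {N k : ℕ} (hk : k + 2 ≤ N) :
    ((N - 2).choose k : ℝ) * radialMoment N (k + 2) =
      (N : ℝ) ^ k * (radialMoment N 0 * momentCoeffB N k) := by
  have h := choose_mul_radialMoment_succ hk
  obtain ⟨r, rfl⟩ := Nat.exists_eq_add_of_le hk
  have h2 : k + 2 + r - (k + 1) = r + 1 := by omega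
  have h3 : k + 2 + r - (k + 2) = r := by omega
  have hN : (0:ℝ) < ((k + 2 + r : ℕ) : ℝ) := by positivity
  have e1 : radialMoment (k + 2 + r) (k + 2) =
      ((k + 2 + r : ℕ) : ℝ) / (r + 1) * radialMoment (k + 2 + r) (k + 1) := by
    rw [radialMoment, radialMoment, h2, h3, Nat.factorial_succ, pow_succ _ (r + 1)]
    push_cast
    field_simp
  have h6 : ((k + 2 + r : ℕ) : ℝ) - k - 1 = r + 1 := by push_cast; ring
  have e2 : momentCoeffB (k + 2 + r) k =
      ((k + 2 + r : ℕ) : ℝ) / (r + 1) * momentCoeffA (k + 2 + r) k := by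
    rw [momentCoeffA, momentCoeffB, h6]
    field_simp
  rw [e1, e2, mul_left_comm, h]
  ring

lemma choose_succ_mul_radialMoment {N k : ℕ} (hk : k + 2 ≤ N) :
    ((N - 2).choose (k + 1) : ℝ) * radialMoment N (k + 2) =
      (N : ℝ) ^ (k + 1) * (radialMoment N 0 * momentCoeffC N k) := by
  have h := choose_mul_radialMoment_add_two hk
  obtain ⟨r, rfl⟩ := Nat.exists_eq_add_of_le hk
  have h1 : k + 2 + r - 2 = k + r := by omega
  have hN : (0:ℝ) < ((k + 2 + r : ℕ) : ℝ) := by positivity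
  have e1 : (((k + r).choose (k + 1) : ℕ) : ℝ) = r / (k + 1) * (k + r).choose k := by
    have := Nat.choose_succ_right_eq (k + r) k
    rw [Nat.add_sub_cancel_left] at this
    have h' : ((k + r).choose (k + 1) : ℝ) * (k + 1) = (k + r).choose k * r := by
      exact_mod_cast this
    field_simp
    linarith
  have h6 : ((k + 2 + r : ℕ) : ℝ) - k - 2 = r := by push_cast; ring
  have e2 : ((k + 2 + r : ℕ) : ℝ) * momentCoeffC (k + 2 + r) k =
      r / (k + 1) * momentCoeffB (k + 2 + r) k := by
    rw [momentCoeffB, momentCoeffC, h6, Nat.factorial_succ]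
    push_cast
    field_simp
  rw [h1] at h ⊢
  rw [e1, mul_assoc, h, pow_succ]
  linear_combination (-(((k + 2 + r : ℕ) : ℝ) ^ k * radialMoment (k + 2 + r) 0)) * e2

/-- The finite sums `∑ t²ᵏ f(N,k) g(N,k)` that build up `Ifun`. -/
noncomputable def momentSum (t : ℝ) (f g : ℕ → ℕ → ℝ) (N : ℕ) : ℝ :=
  ∑ k ∈ Finset.range (N - 1), t ^ (2 * k) * (f N k * g N k)

lemma Ifun_eq_momentSum {t : ℝ} {N : ℕ} (hN : 2 ≤ N) (j : Fin 3) (a₀ a₁ a₂ b₀ b₁ : ℝ)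
    (hU : ∀ R₁ R₂ : ℝ, 0 < R₁ → 0 < R₂ → ∃ c₁ c₂ : ℝ,
      c₁ + c₂ = Real.sqrt (R₁ * R₂) * (b₀ + b₁ * (R₁ + R₂)) ∧
      ∀ θ : ℝ, Ufun t N j R₁ R₂ θ = ((a₀ * (R₁ * R₂) + a₁ + a₂ * (R₁ + R₂) : ℝ) : ℂ) +
      c₁ * Complex.exp ((θ : ℂ) * Complex.I) + c₂ * Complex.exp (-(θ : ℂ) * Complex.I)) :
    Ifun t N j = ((stirlingFactor N * (a₀ * momentSum t momentCoeffA momentCoeffA N +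
      a₁ * momentSum t momentCoeffB momentCoeffB N +
      2 * a₂ * momentSum t momentCoeffA momentCoeffB N +
      b₀ * t * momentSum t momentCoeffB momentCoeffC N +
      2 * b₁ * t * momentSum t momentCoeffA momentCoeffC N) : ℝ) : ℂ) := by
  rw [Ifun_eq hN j a₀ a₁ a₂ b₀ b₁ hU]
  congr 1
  rw [stirlingFactor, mul_assoc]
  congr 1
  simp only [momentSum, Finset.mul_sum, ← Finset.sum_add_distrib]
  refine Finset.sum_congr rfl fun k hk => ?_
  have hk : k + 2 ≤ N := by
    have := Finset.mem_range.1 hk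
    omega
  have hN0 : (N : ℝ) ≠ 0 := by exact_mod_cast (by omega : N ≠ 0)
  have hA := choose_mul_radialMoment_succ hk
  have hB := choose_mul_radialMoment_add_two hk
  have hC := choose_succ_mul_radialMoment hk
  have e1 : (t / N) ^ (2 * k) = t ^ (2 * k) * (((N : ℝ) ^ k)⁻¹ * ((N : ℝ) ^ k)⁻¹) := by
    rw [div_pow, two_mul, pow_add (N : ℝ)]
    field_simp
  have e2 : (t / N) ^ (2 * k + 1) =
      t ^ (2 * k) * t * (((N : ℝ) ^ k)⁻¹ * ((N : ℝ) ^ (k + 1))⁻¹) := by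
    rw [div_pow, show 2 * k + 1 = k + (k + 1) by ring, pow_add (N : ℝ)]
    field_simp
    ring
  have hA' : ((N : ℝ) ^ k)⁻¹ * (((N - 2).choose k : ℝ) * radialMoment N (k + 1)) =
      radialMoment N 0 * momentCoeffA N k := by
    rw [hA, inv_mul_cancel_left₀ (pow_ne_zero _ hN0)]
  have hB' : ((N : ℝ) ^ k)⁻¹ * (((N - 2).choose k : ℝ) * radialMoment N (k + 2)) =
      radialMoment N 0 * momentCoeffB N k := by
    rw [hB, inv_mul_cancel_left₀ (pow_ne_zero _ hN0)]
  have hC' : ((N : ℝ) ^ (k + 1))⁻¹ * (((N - 2).choose (k + 1) : ℝ) * radialMoment N (k + 2)) =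
      radialMoment N 0 * momentCoeffC N k := by
    rw [hC, inv_mul_cancel_left₀ (pow_ne_zero _ hN0)]
  rw [e1, e2]
  generalize ((N : ℝ) ^ k)⁻¹ = x at *
  generalize ((N : ℝ) ^ (k + 1))⁻¹ = y at *
  generalize radialMoment N 0 = q at *
  trans t ^ (2 * k) * (a₀ * (q * momentCoeffA N k) ^ 2 + a₁ * (q * momentCoeffB N k) ^ 2 +
    b₀ * t * ((q * momentCoeffB N k) * (q * momentCoeffC N k)) +
    2 * a₂ * ((q * momentCoeffA N k) * (q * momentCoeffB N k)) +
    2 * b₁ * t * ((q * momentCoeffA N k) * (q * momentCoeffC N k)))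
  · rw [← hA', ← hB', ← hC']
    ring
  · ring

lemma tendsto_momentSum (t : ℝ) {f g : ℕ → ℕ → ℝ} {f' g' : ℕ → ℝ}
    (hf : ∀ N k, k + 2 ≤ N → |f N k| ≤ 2 / k.factorial)
    (hg : ∀ N k, k + 2 ≤ N → |g N k| ≤ 2 / k.factorial)
    (hf' : ∀ k, Tendsto (fun N => f N k) atTop (nhds (f' k)))
    (hg' : ∀ k, Tendsto (fun N => g N k) atTop (nhds (g' k))) :
    Tendsto (momentSum t f g) atTop (nhds (∑' k, t ^ (2 * k) * (f' k * g' k))) := by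
  have key := tendsto_tsum_of_dominated_convergence (𝓕 := atTop)
    (f := fun N k => if k < N - 1 then t ^ (2 * k) * (f N k * g N k) else 0)
    (g := fun k => t ^ (2 * k) * (f' k * g' k))
    (bound := fun k : ℕ => 4 * ((t ^ 2) ^ k / k.factorial))
    ((Real.summable_pow_div_factorial (t ^ 2)).mul_left 4) ?_ ?_
  · refine key.congr fun N => ?_
    rw [momentSum, tsum_eq_sum (s := Finset.range (N - 1))]
    · refine Finset.sum_congr rfl fun k hk => ?_
      rw [if_pos (Finset.mem_range.1 hk)]
    · intro k hk
      rw [if_neg (by simpa using hk)]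
  · intro k
    refine (((hf' k).mul (hg' k)).const_mul (t ^ (2 * k))).congr' ?_
    filter_upwards [eventually_gt_atTop (k + 1)] with N hN
    rw [if_pos (by omega)]
  · refine Eventually.of_forall fun N k => ?_
    split_ifs with hk
    · have hk : k + 2 ≤ N := by omega
      have h1 : (1:ℝ) ≤ k.factorial := by exact_mod_cast Nat.factorial_pos _
      rw [norm_mul, norm_mul, pow_mul, Real.norm_of_nonneg (by positivity : 0 ≤ (t ^ 2) ^ k)]
      calc (t ^ 2) ^ k * (|f N k| * |g N k|)
          ≤ (t ^ 2) ^ k * ((2 / k.factorial) * (2 / k.factorial)) := by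
            gcongr
            · exact hf N k hk
            · exact hg N k hk
        _ ≤ (t ^ 2) ^ k * ((2 / k.factorial) * (2 / 1)) := by gcongr
        _ = 4 * ((t ^ 2) ^ k / k.factorial) := by ring
    · rw [norm_zero]
      positivity

lemma abs_momentCoeffA_le (N k : ℕ) (hk : k + 2 ≤ N) : |momentCoeffA N k| ≤ 2 / k.factorial := by
  have hN : (k : ℝ) + 2 ≤ N := by exact_mod_cast hk
  have hk0 : (0 : ℝ) ≤ k := by positivity
  have h1 : 0 < (N : ℝ) - 1 := by linarith
  rw [momentCoeffA, abs_of_nonneg (div_nonneg (by linarith) (by positivity)), ← div_div]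
  gcongr
  rw [div_le_iff₀ h1]
  linarith

lemma abs_momentCoeffB_le (N k : ℕ) (hk : k + 2 ≤ N) : |momentCoeffB N k| ≤ 2 / k.factorial := by
  have hN : (k : ℝ) + 2 ≤ N := by exact_mod_cast hk
  have hk0 : (0 : ℝ) ≤ k := by positivity
  have h1 : 0 < (N : ℝ) - 1 := by linarith
  rw [momentCoeffB, abs_of_nonneg (by positivity), ← div_div]
  gcongr
  rw [div_le_iff₀ h1]
  linarith

lemma abs_momentCoeffC_le (N k : ℕ) (hk : k + 2 ≤ N) : |momentCoeffC N k| ≤ 2 / k.factorial := by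
  have hN : (k : ℝ) + 2 ≤ N := by exact_mod_cast hk
  have hk0 : (0 : ℝ) ≤ k := by positivity
  have h1 : 0 < (N : ℝ) - 1 := by linarith
  rw [momentCoeffC, abs_of_nonneg (div_nonneg (by linarith) (by positivity)), ← div_div]
  have : (k.factorial : ℝ) ≤ (k + 1).factorial := by
    exact_mod_cast Nat.factorial_le (Nat.le_succ k)
  gcongr
  rw [div_le_iff₀ h1]
  linarith

lemma tendsto_natCast_sub_div (a : ℝ) :
    Tendsto (fun N : ℕ => ((N : ℝ) - a) / ((N : ℝ) - 1)) atTop (nhds 1) := by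
  have h : Tendsto (fun N : ℕ => (N : ℝ) - 1) atTop atTop :=
    tendsto_atTop_add_const_right _ (-1) tendsto_natCast_atTop_atTop
  have h2 := (h.inv_tendsto_atTop.const_mul (1 - a)).const_add 1
  simp only [mul_zero, add_zero] at h2
  refine h2.congr' ?_
  filter_upwards [eventually_gt_atTop 1] with N hN
  have : (N : ℝ) - 1 ≠ 0 := by
    have : (1 : ℝ) < N := by exact_mod_cast hN
    linarith
  simp only [Pi.inv_apply]
  field_simp
  ring

lemma tendsto_momentCoeffA (k : ℕ) :
    Tendsto (fun N => momentCoeffA N k) atTop (nhds (1 / k.factorial)) := by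
  simp only [momentCoeffA, ← div_div, sub_sub]
  exact (tendsto_natCast_sub_div _).div_const _

lemma tendsto_momentCoeffB (k : ℕ) :
    Tendsto (fun N => momentCoeffB N k) atTop (nhds (1 / k.factorial)) := by
  simp only [momentCoeffB, ← div_div]
  simpa using (tendsto_natCast_sub_div 0).div_const (k.factorial : ℝ)

lemma tendsto_momentCoeffC (k : ℕ) :
    Tendsto (fun N => momentCoeffC N k) atTop (nhds (1 / (k + 1).factorial)) := by
  simp only [momentCoeffC, ← div_div, sub_sub]
  exact (tendsto_natCast_sub_div _).div_const _

lemma tendsto_momentSum_A_A (t : ℝ) :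
    Tendsto (momentSum t momentCoeffA momentCoeffA) atTop (nhds (besselSeries 0 (t ^ 2))) := by
  have h := tendsto_momentSum t abs_momentCoeffA_le abs_momentCoeffA_le tendsto_momentCoeffA
    tendsto_momentCoeffA
  convert h using 2
  refine tsum_congr fun k => ?_
  rw [pow_mul, add_zero]
  field_simp

lemma tendsto_momentSum_A_C (t : ℝ) :
    Tendsto (momentSum t momentCoeffA momentCoeffC) atTop (nhds (besselSeries 1 (t ^ 2))) := by
  have h := tendsto_momentSum t abs_momentCoeffA_le abs_momentCoeffC_le tendsto_momentCoeffA
    tendsto_momentCoeffC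
  convert h using 2
  refine tsum_congr fun k => ?_
  rw [pow_mul]
  field_simp

lemma tendsto_const_div_natCast_sub_one (c : ℝ) :
    Tendsto (fun N : ℕ => c / ((N : ℝ) - 1)) atTop (nhds 0) :=
  Tendsto.div_atTop tendsto_const_nhds
    (tendsto_atTop_add_const_right _ (-1) tendsto_natCast_atTop_atTop)

lemma tendsto_Ifun_zero (t : ℝ) :
    Tendsto (fun N => Ifun t N 0) atTop (nhds ((2 * t ^ 2 * besselSeries 1 (t ^ 2) : ℝ) : ℂ)) := by
  have hAB := tendsto_momentSum t abs_momentCoeffA_le abs_momentCoeffB_le tendsto_momentCoeffA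
    tendsto_momentCoeffB
  have h := tendsto_stirlingFactor.mul
    ((((tendsto_const_div_atTop_nhds_zero_nat (t ^ 2)).const_mul 2).mul hAB).add
      ((tendsto_momentSum_A_C t).const_mul (2 * t * t)))
  have h2 := (Complex.continuous_ofReal.tendsto _).comp h
  rw [show 1 * (2 * 0 * ∑' k : ℕ, t ^ (2 * k) * (1 / (k.factorial : ℝ) * (1 / (k.factorial : ℝ))) +
    2 * t * t * besselSeries 1 (t ^ 2)) = 2 * t ^ 2 * besselSeries 1 (t ^ 2) by ring] at h2
  refine h2.congr' ?_
  filter_upwards [eventually_ge_atTop 2] with N hN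
  rw [Ifun_eq_momentSum hN 0 0 0 (t ^ 2 / N) 0 t]
  · simp only [Function.comp_apply]
    congr 1
    ring
  · intro R₁ R₂ _ _
    refine ⟨t * Real.sqrt (R₁ * R₂) * R₂, t * Real.sqrt (R₁ * R₂) * R₁, by ring, fun θ => ?_⟩
    simp only [Ufun, Matrix.cons_val_zero, U0]
    push_cast
    ring

lemma tendsto_momentCombination_one (t : ℝ) :
    Tendsto (fun N : ℕ => ((stirlingFactor N *
      (t * ((N : ℝ) / ((N : ℝ) - 1)) * momentSum t momentCoeffA momentCoeffA N +
      t ^ 3 / ((N : ℝ) ^ 2 * ((N : ℝ) - 1)) * momentSum t momentCoeffB momentCoeffB N +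
      2 * 0 * momentSum t momentCoeffA momentCoeffB N +
      (2 * (t ^ 2 / ((N : ℝ) - 1)) - t ^ 2 / N) * t * momentSum t momentCoeffB momentCoeffC N +
      2 * 0 * t * momentSum t momentCoeffA momentCoeffC N) : ℝ) : ℂ)) atTop
      (nhds ((t * besselSeries 0 (t ^ 2) : ℝ) : ℂ)) := by
  have hBB := tendsto_momentSum t abs_momentCoeffB_le abs_momentCoeffB_le tendsto_momentCoeffB
    tendsto_momentCoeffB
  have hBC := tendsto_momentSum t abs_momentCoeffB_le abs_momentCoeffC_le tendsto_momentCoeffB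
    tendsto_momentCoeffC
  have c0 : Tendsto (fun N : ℕ => t * ((N : ℝ) / ((N : ℝ) - 1))) atTop (nhds t) := by
    simpa using (tendsto_natCast_sub_div 0).const_mul t
  have c1 : Tendsto (fun N : ℕ => t ^ 3 / ((N : ℝ) ^ 2 * ((N : ℝ) - 1))) atTop (nhds 0) := by
    have h := ((tendsto_const_div_atTop_nhds_zero_nat 1).pow 2).mul
      (tendsto_const_div_natCast_sub_one (t ^ 3))
    simp only [mul_zero] at h
    refine h.congr fun N => ?_
    rw [div_pow, div_mul_div_comm, one_pow, one_mul]
  have c2 := ((tendsto_const_div_natCast_sub_one (t ^ 2)).const_mul 2).sub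
    (tendsto_const_div_atTop_nhds_zero_nat (t ^ 2))
  have h := tendsto_stirlingFactor.mul
    (((c0.mul (tendsto_momentSum_A_A t)).add (c1.mul hBB)).add ((c2.mul_const t).mul hBC))
  simp only [mul_zero, zero_mul, sub_zero, add_zero, one_mul] at h ⊢
  exact (Complex.continuous_ofReal.tendsto _).comp h

lemma tendsto_Ifun_one (t : ℝ) :
    Tendsto (fun N => Ifun t N 1) atTop (nhds ((t * besselSeries 0 (t ^ 2) : ℝ) : ℂ)) := by
  refine (tendsto_momentCombination_one t).congr' ?_
  filter_upwards [eventually_ge_atTop 2] with N hN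
  refine (Ifun_eq_momentSum hN 1 _ _ _ _ _ ?_).symm
  intro R₁ R₂ _ _
  refine ⟨(t ^ 2 / ((N : ℝ) - 1) - t ^ 2 / N) * Real.sqrt (R₁ * R₂),
    t ^ 2 / ((N : ℝ) - 1) * Real.sqrt (R₁ * R₂), by ring, fun θ => ?_⟩
  simp only [Ufun, Matrix.cons_val_one, Matrix.cons_val_zero, U1]
  push_cast
  ring

lemma tendsto_Ifun_two (t : ℝ) :
    Tendsto (fun N => Ifun t N 2) atTop (nhds ((t * besselSeries 0 (t ^ 2) : ℝ) : ℂ)) := by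
  refine (tendsto_momentCombination_one t).congr' ?_
  filter_upwards [eventually_ge_atTop 2] with N hN
  refine (Ifun_eq_momentSum hN 2 _ _ _ _ _ ?_).symm
  intro R₁ R₂ _ _
  refine ⟨t ^ 2 / ((N : ℝ) - 1) * Real.sqrt (R₁ * R₂),
    (t ^ 2 / ((N : ℝ) - 1) - t ^ 2 / N) * Real.sqrt (R₁ * R₂), by ring, fun θ => ?_⟩
  simp only [Ufun, Matrix.cons_val, U2]
  push_cast
  ring

/-- For fixed `t > 0`,
`I_{0,N}(t) J₀(t) + (I_{1,N}(t) + I_{2,N}(t)) J₁(t) → 2` as `N → ∞`. -/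
theorem density_combination_tendsto_two (t : ℝ) (ht : 0 < t) :
    Tendsto
      (fun N : ℕ => Ifun t N 0 * ((J0 t : ℝ) : ℂ) + (Ifun t N 1 + Ifun t N 2) * ((J1 t : ℝ) : ℂ))
      atTop (nhds (2 : ℂ)) := by
  have h := ((tendsto_Ifun_zero t).mul_const ((J0 t : ℝ) : ℂ)).add
    (((tendsto_Ifun_one t).add (tendsto_Ifun_two t)).mul_const ((J1 t : ℝ) : ℂ))
  convert h using 2
  have hw := bessel_wronskian (pow_pos ht 2)
  rw [← J0_eq ht, ← mul_J1_eq ht] at hw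
  norm_cast
  linear_combination (-2) * hw
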